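/- Let n ≥ 1, β > 0 and c ∈ ℝ. Then for every smooth compactly supported function g : ℝ^n × ℝ → ℂ one has ‖e^{β(ct+|x|²)} (i ∂_t + Δ_x)(e^{−β(ct+|x|²)} g)‖_{L²(ℝ^n×ℝ)} ≥ β ‖g‖_{L²(ℝ^n×ℝ)} + 2 β^{3/2} ‖|x| g‖_{L²(ℝ^n×ℝ)} + β^{1/2} ‖|∇_x g|‖_{L²(ℝ^n×ℝ)}. -/

import Mathlib

open MeasureTheory

/-- Spatial partial derivative ∂_{x_j} f of a function on ℝⁿ × ℝ. -/
noncomputable def pdX (n : ℕ) (f : EuclideanSpace ℝ (Fin n) × ℝ → ℂ) (j : Fin n)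
    (p : EuclideanSpace ℝ (Fin n) × ℝ) : ℂ :=
  fderiv ℝ f p (EuclideanSpace.single j 1, 0)

/-- Time derivative ∂_t f of a function on ℝⁿ × ℝ. -/
noncomputable def pdT (n : ℕ) (f : EuclideanSpace ℝ (Fin n) × ℝ → ℂ)
    (p : EuclideanSpace ℝ (Fin n) × ℝ) : ℂ :=
  fderiv ℝ f p (0, 1)

/-- Spatial Laplacian Δ_x f. -/
noncomputable def lapX (n : ℕ) (f : EuclideanSpace ℝ (Fin n) × ℝ → ℂ)
    (p : EuclideanSpace ℝ (Fin n) × ℝ) : ℂ :=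
  ∑ j, pdX n (pdX n f j) j p

/-- Euclidean norm of the spatial gradient, |∇_x f|. -/
noncomputable def gradNormX (n : ℕ) (f : EuclideanSpace ℝ (Fin n) × ℝ → ℂ)
    (p : EuclideanSpace ℝ (Fin n) × ℝ) : ℝ :=
  Real.sqrt (∑ j, ‖pdX n f j p‖ ^ 2)

/-- Space-time L² norm of a complex-valued function. -/
noncomputable def L2C (n : ℕ) (f : EuclideanSpace ℝ (Fin n) × ℝ → ℂ) : ℝ :=
  Real.sqrt (∫ p : EuclideanSpace ℝ (Fin n) × ℝ, ‖f p‖ ^ 2)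

/-- Space-time L² norm of a real-valued function. -/
noncomputable def L2R (n : ℕ) (g : EuclideanSpace ℝ (Fin n) × ℝ → ℝ) : ℝ :=
  Real.sqrt (∫ p : EuclideanSpace ℝ (Fin n) × ℝ, (g p) ^ 2)

/-- The Carleman weight e^{β(ct + |x|²)}. -/
noncomputable def wt (n : ℕ) (β c : ℝ) (p : EuclideanSpace ℝ (Fin n) × ℝ) : ℝ :=
  Real.exp (β * (c * p.2 + ‖p.1‖ ^ 2))

namespace CarlemanAbstract
variable {V H ι : Type*} [AddCommGroup V] [Module ℝ V]

theorem commutator_sq_add_sq (D X : Module.End ℝ V) (β : ℝ) (h : D * X = X * D + 1) :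
    (D * D + (4 * β ^ 2) • (X * X)) * (D * X + X * D)
      - (D * X + X * D) * (D * D + (4 * β ^ 2) • (X * X))
      = (4 : ℝ) • (D * D) - (16 * β ^ 2) • (X * X) := by
  have h1 : D * (D * X) = X * (D * D) + (2 : ℝ) • D := by
    rw [h, mul_add, ← mul_assoc, h, two_smul]; noncomm_ring
  have h2 : D * (X * X) = X * X * D + (2 : ℝ) • X := by
    rw [← mul_assoc, h, add_mul, mul_assoc, h, two_smul]; noncomm_ring
  have e1 : D * D * (D * X + X * D) - (D * X + X * D) * (D * D) = (4 : ℝ) • (D * D) := by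
    have : D * D * X = X * (D * D) + (2 : ℝ) • D := by rw [mul_assoc, h1]
    have a1 : D * D * (D * X) = D * X * (D * D) + (2 : ℝ) • (D * D) := by
      rw [show D * D * (D * X) = D * (D * D * X) by noncomm_ring, this, mul_add,
        mul_smul_comm]; noncomm_ring
    have a2 : D * D * (X * D) = X * D * (D * D) + (2 : ℝ) • (D * D) := by
      rw [show D * D * (X * D) = D * D * X * D by noncomm_ring, this, add_mul,
        smul_mul_assoc]; noncomm_ring
    rw [mul_add, add_mul, a1, a2]
    module
  have e2 : X * X * (D * X + X * D) - (D * X + X * D) * (X * X) = (-4 : ℝ) • (X * X) := by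
    have a1 : D * X * (X * X) = X * X * (D * X) + (2 : ℝ) • (X * X) := by
      rw [show D * X * (X * X) = D * (X * X) * X by noncomm_ring, h2, add_mul,
        smul_mul_assoc]; noncomm_ring
    have a2 : X * D * (X * X) = X * X * (X * D) + (2 : ℝ) • (X * X) := by
      rw [show X * D * (X * X) = X * (D * (X * X)) by noncomm_ring, h2, mul_add,
        mul_smul_comm]; noncomm_ring
    rw [mul_add, add_mul, a1, a2]
    module
  rw [add_mul, mul_add _ (D * D), smul_mul_assoc, mul_smul_comm]
  rw [sub_eq_iff_eq_add] at e1 e2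
  rw [e1, e2]
  module

variable [NormedAddCommGroup H] [InnerProductSpace ℝ H] (E : V →ₗ[ℝ] H)

theorem inner_commutator_le_norm_sq (S A : Module.End ℝ V)
    (hS : ∀ u w, inner ℝ (E (S u)) (E w) = inner ℝ (E u) (E (S w)))
    (hA : ∀ u w, inner ℝ (E (A u)) (E w) = -inner ℝ (E u) (E (A w))) (g : V) :
    inner ℝ (E ((S * A - A * S) g)) (E g) ≤ ‖E (S g + A g)‖ ^ 2 := by
  have h1 := hS (A g) g
  have h2 := hA (S g) g
  have h3 := real_inner_comm (E (S g)) (E (A g))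
  rw [map_add, norm_add_sq_real, LinearMap.sub_apply, map_sub, inner_sub_left,
    Module.End.mul_apply, Module.End.mul_apply, h1, h2]
  nlinarith [sq_nonneg ‖E (S g)‖, sq_nonneg ‖E (A g)‖]

variable [Fintype ι] [DecidableEq ι]

/-- Lower bound for the conjugated Schrödinger operator, for abstract canonical variables. -/
theorem lower_bound [Nonempty ι] (D X : ι → Module.End ℝ V) (T J : Module.End ℝ V) (β c : ℝ)
    (hβ : 0 < β)
    (hDX : ∀ k j, D k * X j = X j * D k + if k = j then 1 else 0)
    (hDD : ∀ k j, Commute (D k) (D j)) (hXX : ∀ k j, Commute (X k) (X j))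
    (hTD : ∀ j, Commute T (D j)) (hTX : ∀ j, Commute T (X j))
    (hJD : ∀ j, Commute J (D j)) (hJX : ∀ j, Commute J (X j)) (hJT : Commute J T)
    (aD : ∀ j u w, inner ℝ (E (D j u)) (E w) = -inner ℝ (E u) (E (D j w)))
    (aX : ∀ j u w, inner ℝ (E (X j u)) (E w) = inner ℝ (E u) (E (X j w)))
    (aT : ∀ u w, inner ℝ (E (T u)) (E w) = -inner ℝ (E u) (E (T w)))
    (aJ : ∀ u w, inner ℝ (E (J u)) (E w) = -inner ℝ (E u) (E (J w))) (g : V) :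
    β * ‖E g‖ + 2 * β ^ ((3 : ℝ) / 2) * √(∑ j, ‖E (X j g)‖ ^ 2)
        + √β * √(∑ j, ‖E (D j g)‖ ^ 2)
      ≤ ‖E (J (T g - (β * c) • g) + ∑ j, (D j - (2 * β) • X j) ((D j - (2 * β) • X j) g))‖ := by
  set P : ι → Module.End ℝ V := fun j => D j * D j + (4 * β ^ 2) • (X j * X j) with hP
  set Q : ι → Module.End ℝ V := fun j => D j * X j + X j * D j with hQ
  set S : Module.End ℝ V := J * T + ∑ j, P j with hSdef
  set A : Module.End ℝ V := (-(β * c)) • J + (-(2 * β)) • ∑ j, Q j with hAdef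
  have hL : J (T g - (β * c) • g) + ∑ j, (D j - (2 * β) • X j) ((D j - (2 * β) • X j) g)
      = S g + A g := by
    simp only [hSdef, hAdef, hP, hQ, LinearMap.add_apply, LinearMap.smul_apply,
      LinearMap.sum_apply, Module.End.mul_apply, LinearMap.sub_apply, map_sub, map_smul,
      Finset.smul_sum]
    have : ∀ a b x y : V, a + b + (x + y) = a + x + (b + y) := fun a b x y => by abel
    rw [this, ← Finset.sum_add_distrib]
    congr 1
    · module
    · refine Finset.sum_congr rfl fun j _ => ?_
      module
  have hS : ∀ u w, inner ℝ (E (S u)) (E w) = inner ℝ (E u) (E (S w)) := by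
    intro u w
    have hJT' : J (T w) = T (J w) := congrArg (· w) hJT.eq
    simp only [hSdef, hP, LinearMap.add_apply, LinearMap.smul_apply,
      LinearMap.sum_apply, Module.End.mul_apply, map_add, map_sum, map_smul, inner_add_left,
      inner_add_right, sum_inner, inner_sum, inner_smul_left, inner_smul_right, aD, aX, aT, aJ,
      neg_neg, hJT']
    simp
  have hA : ∀ u w, inner ℝ (E (A u)) (E w) = -inner ℝ (E u) (E (A w)) := by
    intro u w
    simp only [hAdef, hQ, LinearMap.add_apply, LinearMap.smul_apply,
      LinearMap.sum_apply, Module.End.mul_apply, map_add, map_sum, map_smul, inner_add_left,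
      inner_add_right, sum_inner, inner_sum, inner_smul_left, inner_smul_right, aD, aX, aJ]
    simp only [conj_trivial, Finset.sum_add_distrib, Finset.sum_neg_distrib]
    ring
  have hDXne : ∀ k j, k ≠ j → Commute (D k) (X j) := fun k j h => by
    have := hDX k j
    rwa [if_neg h, add_zero] at this
  have hPQ : ∀ k j, P k * Q j - Q j * P k
      = if k = j then (4 : ℝ) • (D k * D k) - (16 * β ^ 2) • (X k * X k) else 0 := by
    intro k j
    split_ifs with h
    · subst h
      exact commutator_sq_add_sq _ _ _ (by simpa using hDX k k)
    · have c1 := hDXne k j h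
      have c2 := (hDXne j k (Ne.symm h)).symm
      have d1 : Commute (D k) (Q j) :=
        ((hDD k j).mul_right c1).add_right (c1.mul_right (hDD k j))
      have d2 : Commute (X k) (Q j) :=
        (c2.mul_right (hXX k j)).add_right ((hXX k j).mul_right c2)
      exact sub_eq_zero.2 ((d1.mul_left d1).add_left ((d2.mul_left d2).smul_left _)).eq
  have hcomm : S * A - A * S
      = ∑ j, ((-(8 * β)) • (D j * D j) + (32 * β ^ 3) • (X j * X j)) := by
    have hJP : Commute J (∑ j, P j) := Commute.sum_right _ _ _ fun j _ =>
      ((hJD j).mul_right (hJD j)).add_right (((hJX j).mul_right (hJX j)).smul_right _)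
    have hJS : Commute J S := ((Commute.refl J).mul_right hJT).add_right hJP
    have hJTQ : Commute (J * T) (∑ j, Q j) := Commute.sum_right _ _ _ fun j _ =>
      Commute.add_right (((hJD j).mul_left (hTD j)).mul_right ((hJX j).mul_left (hTX j)))
        (((hJX j).mul_left (hTX j)).mul_right ((hJD j).mul_left (hTD j)))
    have hPQs : (∑ k, P k) * (∑ j, Q j) - (∑ j, Q j) * (∑ k, P k)
        = ∑ j, ((4 : ℝ) • (D j * D j) - (16 * β ^ 2) • (X j * X j)) := by
      rw [Finset.sum_mul_sum, Finset.sum_mul_sum, Finset.sum_comm, ← Finset.sum_sub_distrib]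
      refine Finset.sum_congr rfl fun j _ => ?_
      rw [← Finset.sum_sub_distrib, Finset.sum_congr rfl fun k _ => hPQ k j]
      simp
    have : S * A - A * S
        = (-(2 * β)) • ((∑ k, P k) * (∑ j, Q j) - (∑ j, Q j) * (∑ k, P k)) := by
      have e1 : ∀ {R J' Q' : Module.End ℝ V} (a b : ℝ), Commute J' R →
          R * (a • J' + b • Q') - (a • J' + b • Q') * R = b • (R * Q' - Q' * R) := by
        intro R J' Q' a b h
        rw [mul_add, add_mul, mul_smul_comm, smul_mul_assoc, h.eq, add_sub_add_left_eq_sub,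
          mul_smul_comm, smul_mul_assoc, ← smul_sub]
      have e2 : ∀ {Z P' Q' : Module.End ℝ V}, Commute Z Q' →
          (Z + P') * Q' - Q' * (Z + P') = P' * Q' - Q' * P' := by
        intro Z P' Q' h
        rw [add_mul, mul_add, h.eq, add_sub_add_left_eq_sub]
      rw [hAdef, e1 _ _ hJS, hSdef, e2 hJTQ]
    rw [this, hPQs, Finset.smul_sum]
    refine Finset.sum_congr rfl fun j _ => ?_
    module
  have key := inner_commutator_le_norm_sq E S A hS hA g
  have hval : inner ℝ (E ((S * A - A * S) g)) (E g)
      = 8 * β * ∑ j, ‖E (D j g)‖ ^ 2 + 32 * β ^ 3 * ∑ j, ‖E (X j g)‖ ^ 2 := by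
    have hDs : ∀ j, inner ℝ (E (D j (D j g))) (E g) = -‖E (D j g)‖ ^ 2 := fun j => by
      rw [aD, real_inner_self_eq_norm_sq]
    have hXs : ∀ j, inner ℝ (E (X j (X j g))) (E g) = ‖E (X j g)‖ ^ 2 := fun j => by
      rw [aX, real_inner_self_eq_norm_sq]
    rw [hcomm]
    simp only [LinearMap.add_apply, LinearMap.smul_apply,
      LinearMap.sum_apply, Module.End.mul_apply, map_add, map_sum, map_smul, inner_add_left,
      sum_inner, inner_smul_left, hDs, hXs, conj_trivial,
      Finset.sum_add_distrib, ← Finset.mul_sum, Finset.sum_neg_distrib]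
    ring
  have hunc : 2 * β * ‖E g‖ ^ 2
      ≤ 4 * β ^ 2 * ∑ j, ‖E (X j g)‖ ^ 2 + ∑ j, ‖E (D j g)‖ ^ 2 := by
    have hj : ∀ j, 2 * β * ‖E g‖ ^ 2 ≤ 4 * β ^ 2 * ‖E (X j g)‖ ^ 2 + ‖E (D j g)‖ ^ 2 := by
      intro j
      have h1 : E (D j (X j g)) = E (X j (D j g)) + E g := by
        rw [← map_add]
        congr 1
        simpa using congrArg (· g) (hDX j j)
      have h2 := aD j (X j g) g
      have h3 := aX j (D j g) g
      have h7 := real_inner_comm (E (D j g)) (E (X j g))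
      rw [h1, inner_add_left, h3, real_inner_self_eq_norm_sq] at h2
      have h4 := norm_add_sq_real ((2 * β) • E (X j g)) (E (D j g))
      rw [inner_smul_left, norm_smul, mul_pow, Real.norm_eq_abs, sq_abs, conj_trivial] at h4
      have h5 := sq_nonneg ‖(2 * β) • E (X j g) + E (D j g)‖
      have h6 : 2 * β * ‖E g‖ ^ 2 = -(4 * β * inner ℝ (E (X j g)) (E (D j g))) := by
        linear_combination (2 * β) * h2 + (2 * β) * h7
      nlinarith
    obtain ⟨i⟩ := ‹Nonempty ι›
    have h1 := Finset.single_le_sum (f := fun j => 4 * β ^ 2 * ‖E (X j g)‖ ^ 2 + ‖E (D j g)‖ ^ 2)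
      (fun j _ => by positivity) (Finset.mem_univ i)
    rw [Finset.sum_add_distrib, ← Finset.mul_sum] at h1
    exact (hj i).trans h1
  rw [hL]
  refine le_of_sq_le_sq ?_ (norm_nonneg _)
  refine le_trans ?_ key
  rw [hval]
  have hx : 0 ≤ ∑ j, ‖E (X j g)‖ ^ 2 := by positivity
  have hd : 0 ≤ ∑ j, ‖E (D j g)‖ ^ 2 := by positivity
  have hb : (2 * β ^ ((3 : ℝ) / 2) * √(∑ j, ‖E (X j g)‖ ^ 2)) ^ 2
      = 4 * β ^ 3 * ∑ j, ‖E (X j g)‖ ^ 2 := by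
    rw [mul_pow, mul_pow, Real.sq_sqrt hx, ← Real.rpow_natCast, ← Real.rpow_natCast,
      ← Real.rpow_natCast (n := 3), ← Real.rpow_mul hβ.le]
    norm_num
  have ha : (√β * √(∑ j, ‖E (D j g)‖ ^ 2)) ^ 2 = β * ∑ j, ‖E (D j g)‖ ^ 2 := by
    rw [mul_pow, Real.sq_sqrt hd, Real.sq_sqrt hβ.le]
  have hz := mul_le_mul_of_nonneg_left hunc hβ.le
  generalize 2 * β ^ ((3 : ℝ) / 2) * √(∑ j, ‖E (X j g)‖ ^ 2) = b at *
  generalize √β * √(∑ j, ‖E (D j g)‖ ^ 2) = a at *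
  nlinarith [sq_nonneg (β * ‖E g‖ - b), sq_nonneg (β * ‖E g‖ - a), sq_nonneg (a - b), sq_nonneg a,
    sq_nonneg b]

end CarlemanAbstract

open scoped SchwartzMap LineDeriv

namespace SchwartzMap

section L2

variable {M : Type*} [NormedAddCommGroup M] [NormedSpace ℝ M]
  [MeasurableSpace M] [BorelSpace M] {μ : Measure M} [μ.HasTemperateGrowth]

theorem real_inner_toL2_toL2_eq (u w : 𝓢(M, ℂ)) :
    inner ℝ (toLpCLM ℝ ℂ 2 μ u) (toLpCLM ℝ ℂ 2 μ w) = ∫ x, inner ℝ (u x) (w x) ∂μ := by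
  apply integral_congr_ae
  filter_upwards [u.coeFn_toLp 2 μ, w.coeFn_toLp 2 μ] with _ hu hw
  rw [toLpCLM_apply, toLpCLM_apply, hu, hw]

theorem norm_toL2_sq (u : 𝓢(M, ℂ)) : ‖toLpCLM ℝ ℂ 2 μ u‖ ^ 2 = ∫ x, ‖u x‖ ^ 2 ∂μ := by
  simp only [← real_inner_self_eq_norm_sq, real_inner_toL2_toL2_eq]

theorem integrable_norm_sq (u : 𝓢(M, ℂ)) : Integrable (fun x => ‖u x‖ ^ 2) μ :=
  (memLp_two_iff_integrable_sq_norm (u.memLp 2 μ).1).1 (u.memLp 2 μ)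

theorem inner_toL2_lineDeriv [FiniteDimensional ℝ M] [μ.IsAddHaarMeasure] (v : M) (u w : 𝓢(M, ℂ)) :
    inner ℝ (toLpCLM ℝ ℂ 2 μ (∂_{v} u)) (toLpCLM ℝ ℂ 2 μ w)
      = -inner ℝ (toLpCLM ℝ ℂ 2 μ u) (toLpCLM ℝ ℂ 2 μ (∂_{v} w)) := by
  rw [real_inner_toL2_toL2_eq, real_inner_toL2_toL2_eq]
  exact (neg_eq_iff_eq_neg.2
    (integral_bilinear_lineDerivOp_right_eq_neg_left (μ := μ) u w (innerSL ℝ) v)).symm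

end L2

section Operators

variable (M : Type*) [NormedAddCommGroup M] [NormedSpace ℝ M]

/-- Directional derivative as an endomorphism of Schwartz space. -/
noncomputable def derivEnd (v : M) : Module.End ℝ 𝓢(M, ℂ) :=
  (LineDeriv.lineDerivOpCLM ℝ 𝓢(M, ℂ) v).toLinearMap

/-- Multiplication by a linear functional as an endomorphism of Schwartz space. -/
noncomputable def mulEnd (l : M →L[ℝ] ℝ) : Module.End ℝ 𝓢(M, ℂ) :=
  (smulLeftCLM ℂ l).toLinearMap

/-- Multiplication by the imaginary unit as an endomorphism of Schwartz space. -/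
noncomputable def mulI : Module.End ℝ 𝓢(M, ℂ) where
  toFun u := Complex.I • u
  map_add' := smul_add _
  map_smul' _ _ := smul_comm _ _ _

variable {M}

theorem derivEnd_apply (v : M) (u : 𝓢(M, ℂ)) (p : M) : derivEnd M v u p = fderiv ℝ u p v := rfl

theorem mulEnd_apply (l : M →L[ℝ] ℝ) (u : 𝓢(M, ℂ)) (p : M) :
    mulEnd M l u p = (l p : ℂ) * u p := by
  have hl : Function.HasTemperateGrowth l := by fun_prop
  exact (smulLeftCLM_apply_apply hl u p).trans Complex.real_smul

theorem mulI_apply (u : 𝓢(M, ℂ)) (p : M) : mulI M u p = Complex.I * u p := rfl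

theorem derivEnd_mul_mulEnd (v : M) (l : M →L[ℝ] ℝ) :
    derivEnd M v * mulEnd M l = mulEnd M l * derivEnd M v + l v • 1 := by
  ext u p
  have h1 : (mulEnd M l u : M → ℂ) = fun q => (l q : ℂ) * u q := funext (mulEnd_apply l u)
  have h2 : HasFDerivAt (fun q => (l q : ℂ)) (Complex.ofRealCLM ∘L l) p :=
    (Complex.ofRealCLM ∘L l).hasFDerivAt
  have h3 := (h2.mul (u.hasFDerivAt p)).fderiv
  simp only [Module.End.mul_apply, LinearMap.add_apply, LinearMap.smul_apply, Module.End.one_apply,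
    add_apply, smul_apply, mulEnd_apply, derivEnd_apply]
  rw [h1]
  erw [h3]
  simp [mul_comm]

theorem commute_derivEnd (v w : M) : Commute (derivEnd M v) (derivEnd M w) := by
  ext u p
  have hs : IsSymmSndFDerivAt ℝ u p :=
    (u.smooth 2).contDiffAt.isSymmSndFDerivAt (by simp)
  have h : ∀ a b, derivEnd M a (derivEnd M b u) p = fderiv ℝ (fderiv ℝ u) p a b := by
    intro a b
    rw [derivEnd_apply]
    have h1 : (derivEnd M b u : M → ℂ) = fun q => fderiv ℝ u q b := rfl
    have h2 : DifferentiableAt ℝ (fderiv ℝ u) p :=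
      ((u.smooth 2).fderiv_right (m := 1) (by norm_num)).differentiable (by norm_num) p
    rw [h1, fderiv_clm_apply h2 (differentiableAt_const b)]
    simp
  rw [Module.End.mul_apply, Module.End.mul_apply, h, h, hs.eq]

theorem commute_mulEnd (l m : M →L[ℝ] ℝ) : Commute (mulEnd M l) (mulEnd M m) := by
  ext u p
  simp only [Module.End.mul_apply, mulEnd_apply]
  ring

theorem commute_mulI_mulEnd (l : M →L[ℝ] ℝ) : Commute (mulI M) (mulEnd M l) := by
  ext u p
  simp only [Module.End.mul_apply, mulEnd_apply, mulI_apply]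
  ring

theorem commute_mulI_derivEnd (v : M) : Commute (mulI M) (derivEnd M v) := by
  ext u p
  simp only [Module.End.mul_apply, derivEnd_apply, mulI_apply]
  have h1 : (mulI M u : M → ℂ) = fun q => Complex.I * u q := rfl
  rw [h1, fderiv_const_mul (u.differentiableAt)]
  simp

theorem commute_derivEnd_mulEnd {v : M} {l : M →L[ℝ] ℝ} (h : l v = 0) :
    Commute (derivEnd M v) (mulEnd M l) := by
  have := derivEnd_mul_mulEnd v l
  rwa [h, zero_smul, add_zero] at this

section L2

variable [MeasurableSpace M] [BorelSpace M] {μ : Measure M} [μ.HasTemperateGrowth]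

theorem inner_toL2_mulEnd (l : M →L[ℝ] ℝ) (u w : 𝓢(M, ℂ)) :
    inner ℝ (toLpCLM ℝ ℂ 2 μ (mulEnd M l u)) (toLpCLM ℝ ℂ 2 μ w)
      = inner ℝ (toLpCLM ℝ ℂ 2 μ u) (toLpCLM ℝ ℂ 2 μ (mulEnd M l w)) := by
  simp only [real_inner_toL2_toL2_eq, mulEnd_apply, ← Complex.real_smul, real_inner_smul_left,
    real_inner_smul_right]

theorem inner_toL2_mulI (u w : 𝓢(M, ℂ)) :
    inner ℝ (toLpCLM ℝ ℂ 2 μ (mulI M u)) (toLpCLM ℝ ℂ 2 μ w)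
      = -inner ℝ (toLpCLM ℝ ℂ 2 μ u) (toLpCLM ℝ ℂ 2 μ (mulI M w)) := by
  rw [real_inner_toL2_toL2_eq, real_inner_toL2_toL2_eq, ← integral_neg]
  congr 1
  funext p
  simp [mulI_apply, Complex.inner]
  ring

end L2

end Operators

end SchwartzMap

section Conjugation

variable {n : ℕ}

/-- The linear functional `(x, t) ↦ x j`. -/
noncomputable def coordX (j : Fin n) : EuclideanSpace ℝ (Fin n) × ℝ →L[ℝ] ℝ :=
  EuclideanSpace.proj j ∘L ContinuousLinearMap.fst ℝ _ _

theorem coordX_apply (j : Fin n) (p : EuclideanSpace ℝ (Fin n) × ℝ) : coordX j p = p.1 j := rfl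

theorem hasFDerivAt_exp_neg_weight (β c : ℝ) (p : EuclideanSpace ℝ (Fin n) × ℝ) :
    HasFDerivAt (fun q : EuclideanSpace ℝ (Fin n) × ℝ =>
        (Real.exp (-(β * (c * q.2 + ‖q.1‖ ^ 2))) : ℂ))
      (Complex.ofRealCLM ∘L (Real.exp (-(β * (c * p.2 + ‖p.1‖ ^ 2))) •
        -(β • (c • ContinuousLinearMap.snd ℝ (EuclideanSpace ℝ (Fin n)) ℝ
          + (2 • innerSL ℝ p.1) ∘L ContinuousLinearMap.fst ℝ _ ℝ)))) p := by
  have h1 : HasFDerivAt (fun q : EuclideanSpace ℝ (Fin n) × ℝ => ‖q.1‖ ^ 2)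
      ((2 • innerSL ℝ p.1) ∘L ContinuousLinearMap.fst ℝ _ ℝ) p :=
    (hasStrictFDerivAt_norm_sq p.1).hasFDerivAt.comp p hasFDerivAt_fst
  have h2 : HasFDerivAt (fun q : EuclideanSpace ℝ (Fin n) × ℝ => c * q.2)
      (c • ContinuousLinearMap.snd ℝ (EuclideanSpace ℝ (Fin n)) ℝ) p :=
    hasFDerivAt_snd.const_mul c
  exact Complex.ofRealCLM.hasFDerivAt.comp p (((h2.add h1).const_mul β).neg.exp)

theorem pdX_exp_neg_weight_mul (β c : ℝ) {f : EuclideanSpace ℝ (Fin n) × ℝ → ℂ}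
    (hf : Differentiable ℝ f) (j : Fin n) :
    pdX n (fun q => (Real.exp (-(β * (c * q.2 + ‖q.1‖ ^ 2))) : ℂ) * f q) j
      = fun p => (Real.exp (-(β * (c * p.2 + ‖p.1‖ ^ 2))) : ℂ)
          * (pdX n f j p - (2 * β : ℝ) * ((p.1 j : ℂ) * f p)) := by
  funext p
  have h := ((hasFDerivAt_exp_neg_weight β c p).mul (hf p).hasFDerivAt).fderiv
  unfold pdX
  erw [h]
  simp [EuclideanSpace.inner_single_right]
  ring

theorem pdT_exp_neg_weight_mul (β c : ℝ) {f : EuclideanSpace ℝ (Fin n) × ℝ → ℂ}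
    (hf : Differentiable ℝ f) (p : EuclideanSpace ℝ (Fin n) × ℝ) :
    pdT n (fun q => (Real.exp (-(β * (c * q.2 + ‖q.1‖ ^ 2))) : ℂ) * f q) p
      = (Real.exp (-(β * (c * p.2 + ‖p.1‖ ^ 2))) : ℂ)
          * (pdT n f p - (β * c : ℝ) * f p) := by
  have h := ((hasFDerivAt_exp_neg_weight β c p).mul (hf p).hasFDerivAt).fderiv
  unfold pdT
  erw [h]
  simp
  ring

open SchwartzMap
theorem wt_mul_schrodinger_exp_neg_weight_mul (β c : ℝ)
    (u : 𝓢(EuclideanSpace ℝ (Fin n) × ℝ, ℂ)) (p : EuclideanSpace ℝ (Fin n) × ℝ) :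
    (wt n β c p : ℂ) *
        (Complex.I * pdT n (fun q => ((Real.exp (-(β * (c * q.2 + ‖q.1‖ ^ 2)))) : ℂ) * u q) p
          + lapX n (fun q => ((Real.exp (-(β * (c * q.2 + ‖q.1‖ ^ 2)))) : ℂ) * u q) p)
      = (mulI _ (derivEnd _ (0, 1) u - (β * c) • u)
        + ∑ j, (derivEnd (EuclideanSpace ℝ (Fin n) × ℝ) (EuclideanSpace.single j 1, 0)
            - (2 * β) • mulEnd _ (coordX j))
          ((derivEnd (EuclideanSpace ℝ (Fin n) × ℝ) (EuclideanSpace.single j 1, 0)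
            - (2 * β) • mulEnd _ (coordX j)) u)) p := by
  set B : Fin n → Module.End ℝ 𝓢(EuclideanSpace ℝ (Fin n) × ℝ, ℂ) := fun j =>
    derivEnd (EuclideanSpace ℝ (Fin n) × ℝ) (EuclideanSpace.single j 1, 0) - (2 * β) • mulEnd _ (coordX j) with hB
  have hBp : ∀ (j : Fin n) (w : 𝓢(EuclideanSpace ℝ (Fin n) × ℝ, ℂ)),
      (fun p => pdX n w j p - (2 * β : ℝ) * ((p.1 j : ℂ) * w p)) = B j w := by
    intro j w
    funext p
    simp only [hB, LinearMap.sub_apply, LinearMap.smul_apply, sub_apply,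
      smul_apply, mulEnd_apply, coordX_apply, Complex.real_smul]
    rfl
  have hpd : ∀ (j : Fin n) (w : 𝓢(EuclideanSpace ℝ (Fin n) × ℝ, ℂ)),
      pdX n (fun q => (Real.exp (-(β * (c * q.2 + ‖q.1‖ ^ 2))) : ℂ) * w q) j
        = fun p => (Real.exp (-(β * (c * p.2 + ‖p.1‖ ^ 2))) : ℂ) * B j w p := by
    intro j w
    rw [pdX_exp_neg_weight_mul β c w.differentiable j, ← hBp]
  have hw : (wt n β c p : ℂ) * (Real.exp (-(β * (c * p.2 + ‖p.1‖ ^ 2))) : ℂ) = 1 := by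
    rw [wt, ← Complex.ofReal_mul, ← Real.exp_add, add_neg_cancel, Real.exp_zero,
      Complex.ofReal_one]
  rw [pdT_exp_neg_weight_mul β c u.differentiable, lapX]
  simp only [hpd]
  rw [← Finset.mul_sum, mul_left_comm Complex.I, ← mul_add, ← mul_assoc, hw, one_mul,
    _root_.add_apply, _root_.sum_apply]
  simp only [mulI_apply, sub_apply, smul_apply, Complex.real_smul]
  rfl

end Conjugation

open SchwartzMap

/-- Lower bound for the conjugated operator:
`‖e^{β(ct+|x|²)} (i∂_t + Δ_x)(e^{-β(ct+|x|²)} g)‖_{L²}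
  ≥ β ‖g‖_{L²} + 2β^{3/2} ‖|x| g‖_{L²} + β^{1/2} ‖|∇_x g|‖_{L²}`. -/
theorem conjugated_lower_bound (n : ℕ) (hn : 1 ≤ n) (β c : ℝ) (hβ : 0 < β)
    (g : EuclideanSpace ℝ (Fin n) × ℝ → ℂ)
    (hg : ContDiff ℝ (⊤ : ℕ∞) g) (hsupp : HasCompactSupport g) :
    β * L2C n g
      + 2 * β ^ ((3 : ℝ) / 2) * L2R n (fun p => ‖p.1‖ * ‖g p‖)
      + Real.sqrt β * L2R n (gradNormX n g)
    ≤ L2C n (fun p => (wt n β c p : ℂ) *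
        (Complex.I * pdT n (fun q => ((Real.exp (-(β * (c * q.2 + ‖q.1‖ ^ 2)))) : ℂ) * g q) p
          + lapX n (fun q => ((Real.exp (-(β * (c * q.2 + ‖q.1‖ ^ 2)))) : ℂ) * g q) p)) := by
  have : (volume : Measure (EuclideanSpace ℝ (Fin n) × ℝ)).IsAddHaarMeasure :=
    inferInstanceAs
      ((volume : Measure (EuclideanSpace ℝ (Fin n))).prod (volume : Measure ℝ)).IsAddHaarMeasure
  have : Nonempty (Fin n) := ⟨⟨0, hn⟩⟩
  let u : 𝓢(EuclideanSpace ℝ (Fin n) × ℝ, ℂ) := hsupp.toSchwartzMap hg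
  have hgu : g = u := rfl
  have key := CarlemanAbstract.lower_bound
    (toLpCLM ℝ ℂ 2 (volume : Measure (EuclideanSpace ℝ (Fin n) × ℝ))).toLinearMap
    (fun j : Fin n => derivEnd _ (EuclideanSpace.single j 1, 0)) (fun j => mulEnd _ (coordX j))
    (derivEnd _ (0, 1)) (mulI _) β c hβ
    (fun k j => by
      rw [derivEnd_mul_mulEnd, coordX_apply]
      simp [eq_comm])
    (fun _ _ => commute_derivEnd _ _) (fun _ _ => commute_mulEnd _ _)
    (fun _ => commute_derivEnd _ _)
    (fun _ => commute_derivEnd_mulEnd (by simp [coordX_apply]))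
    (fun _ => commute_mulI_derivEnd _) (fun _ => commute_mulI_mulEnd _) (commute_mulI_derivEnd _)
    (fun _ u w => inner_toL2_lineDeriv _ u w)
    (fun _ u w => inner_toL2_mulEnd _ u w)
    (fun u w => inner_toL2_lineDeriv _ u w) inner_toL2_mulI u
  have hL2 : ∀ w : 𝓢(EuclideanSpace ℝ (Fin n) × ℝ, ℂ),
      L2C n w = ‖toLpCLM ℝ ℂ 2 (volume : Measure (EuclideanSpace ℝ (Fin n) × ℝ)) w‖ := by
    intro w
    rw [L2C, ← norm_toL2_sq, Real.sqrt_sq (norm_nonneg _)]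
  have hX : L2R n (fun p => ‖p.1‖ * ‖g p‖)
      = √(∑ j, ‖toLpCLM ℝ ℂ 2 volume (mulEnd _ (coordX j) u)‖ ^ 2) := by
    simp only [L2R, norm_toL2_sq]
    rw [← integral_finsetSum _ fun j _ => integrable_norm_sq _]
    congr 2
    funext p
    simp only [mulEnd_apply, coordX_apply, norm_mul, mul_pow, Complex.norm_real,
      EuclideanSpace.norm_sq_eq, Finset.sum_mul, hgu]
  have hD : L2R n (gradNormX n g) = √(∑ j, ‖toLpCLM ℝ ℂ 2 volume
      (derivEnd (EuclideanSpace ℝ (Fin n) × ℝ) (EuclideanSpace.single j 1, 0) u)‖ ^ 2) := by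
    simp only [L2R, norm_toL2_sq]
    rw [← integral_finsetSum _ fun j _ => integrable_norm_sq _]
    congr 2
    funext p
    rw [gradNormX, Real.sq_sqrt (by positivity)]
    rfl
  rw [hX, hD, hgu, funext (wt_mul_schrodinger_exp_neg_weight_mul β c u), hL2, hL2]
  exact key
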